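/- arXiv:1509.01732 — 3 statements merged into one kernel-verified Lean document; each statement's English description precedes it below -/
import Mathlib

section
/- In the braid group B₃, let h = (σ₁σ₂)³ denote the full positive twist. For every integer d ≥ 1 and every m ∈ {1, 2, 3}, the braid h^d · σ₁^{−m} · σ₂^{−1} is quasipositive. -/
/-- The braid relations on `m` generators `σ_1, …, σ_m` (indexed by `Fin m`):
far commutation `σ_i σ_j = σ_j σ_i` for `j ≥ i + 2`, and the braid relation
`σ_i σ_{i+1} σ_i = σ_{i+1} σ_i σ_{i+1}`. -/
def braidRels (m : ℕ) : Set (FreeGroup (Fin m)) :=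
  { r | ∃ i j : Fin m, (i : ℕ) + 2 ≤ (j : ℕ) ∧
      r = FreeGroup.of i * FreeGroup.of j * (FreeGroup.of i)⁻¹ * (FreeGroup.of j)⁻¹ } ∪
  { r | ∃ i j : Fin m, (j : ℕ) = (i : ℕ) + 1 ∧
      r = FreeGroup.of i * FreeGroup.of j * FreeGroup.of i *
        (FreeGroup.of j * FreeGroup.of i * FreeGroup.of j)⁻¹ }

/-- The braid group `B_n` on `n` strands, presented with generators
`σ_1, …, σ_{n-1}` (indexed by `Fin (n-1)`). -/
abbrev BraidGroup (n : ℕ) := PresentedGroup (braidRels (n - 1))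

/-- The standard generator `σ_{i+1}` of `B_n` (index `i : Fin (n-1)` corresponds
to the generator `σ_{i+1}` in the usual 1-based notation). -/
def braidGen {n : ℕ} (i : Fin (n - 1)) : BraidGroup n := PresentedGroup.of i

/-- A braid is quasipositive if it lies in the submonoid generated by all
conjugates `w σ_i w⁻¹` of the standard generators. -/
def Quasipositive {n : ℕ} (β : BraidGroup n) : Prop :=
  β ∈ Submonoid.closure
    { x : BraidGroup n | ∃ (w : BraidGroup n) (i : Fin (n - 1)), x = w * braidGen i * w⁻¹ }

/-- `σ₁ ∈ B₃`. -/
def σ₁ : BraidGroup 3 := braidGen ⟨0, by norm_num⟩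

/-- `σ₂ ∈ B₃`. -/
def σ₂ : BraidGroup 3 := braidGen ⟨1, by norm_num⟩

theorem braid_relation : σ₁ * σ₂ * σ₁ = σ₂ * σ₁ * σ₂ := by
  have h : (PresentedGroup.mk (braidRels (3 - 1))) _ = 1 :=
    PresentedGroup.one_of_mem (Or.inr ⟨(⟨0, by norm_num⟩ : Fin (3 - 1)), ⟨1, by norm_num⟩, rfl, rfl⟩)
  rw [map_mul, map_inv, mul_inv_eq_one] at h
  simp only [map_mul] at h
  exact h

theorem full_twist_eq : (σ₁ * σ₂) ^ 3 = σ₂ * σ₁ * σ₁ * σ₂ * σ₁ * σ₁ := by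
  calc (σ₁ * σ₂) ^ 3 = (σ₁ * σ₂ * σ₁) * (σ₂ * σ₁ * σ₂) := by
        simp only [pow_succ, pow_zero, one_mul, mul_assoc]
    _ = (σ₂ * σ₁ * σ₂) * (σ₁ * σ₂ * σ₁) := by rw [braid_relation]
    _ = σ₂ * σ₁ * (σ₂ * σ₁ * σ₂) * σ₁ := by simp only [mul_assoc]
    _ = σ₂ * σ₁ * σ₁ * σ₂ * σ₁ * σ₁ := by
        rw [← braid_relation]
        simp only [mul_assoc]

namespace Quasipositive

variable {n : ℕ} {β γ : BraidGroup n}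

theorem mul (hβ : Quasipositive β) (hγ : Quasipositive γ) : Quasipositive (β * γ) :=
  Submonoid.mul_mem _ hβ hγ

theorem pow (hβ : Quasipositive β) (k : ℕ) : Quasipositive (β ^ k) :=
  Submonoid.pow_mem _ hβ k

theorem conj_braidGen (w : BraidGroup n) (i : Fin (n - 1)) :
    Quasipositive (w * braidGen i * w⁻¹) :=
  Submonoid.subset_closure ⟨w, i, rfl⟩

theorem of_braidGen (i : Fin (n - 1)) : Quasipositive (braidGen i : BraidGroup n) := by
  simpa using conj_braidGen 1 i

end Quasipositive

theorem quasipositive_full_twist_mul (m : ℕ) (hm : m = 1 ∨ m = 2 ∨ m = 3) :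
    Quasipositive ((σ₁ * σ₂) ^ 3 * (σ₁⁻¹) ^ m * σ₂⁻¹) := by
  have h₁ : Quasipositive σ₁ := .of_braidGen _
  have h₂ : Quasipositive σ₂ := .of_braidGen _
  have hc₁ : Quasipositive (σ₂ * σ₁ * σ₂⁻¹) := .conj_braidGen _ _
  have hc₂ : Quasipositive (σ₂ * σ₁ * σ₂ * (σ₂ * σ₁)⁻¹) := .conj_braidGen _ _
  rw [full_twist_eq]
  rcases hm with rfl | rfl | rfl
  · convert ((h₂.mul h₁).mul h₁).mul hc₁ using 1
    group
  · convert (h₂.mul h₁).mul h₁ using 1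
    group
  · convert hc₁.mul hc₂ using 1
    group

/-- For every `d ≥ 1` and `m ∈ {1,2,3}`, the 3-braid `h^d σ₁^{-m} σ₂^{-1}`,
where `h = (σ₁σ₂)³` is the full twist, is quasipositive. -/
theorem murasugi_type_c'_quasipositive (d : ℤ) (hd : 1 ≤ d) (m : ℕ)
    (hm : m = 1 ∨ m = 2 ∨ m = 3) :
    Quasipositive (((σ₁ * σ₂) ^ 3) ^ d * (σ₁⁻¹) ^ m * σ₂⁻¹) := by
  have hd' : d = ((d - 1).toNat : ℤ) + 1 := by omega
  have hpos : Quasipositive ((σ₁ * σ₂) ^ 3) :=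
    ((Quasipositive.of_braidGen _).mul (.of_braidGen _)).pow 3
  rw [hd', zpow_add_one, zpow_natCast, mul_assoc, mul_assoc,
    ← mul_assoc ((σ₁ * σ₂) ^ 3) _ (σ₂⁻¹)]
  exact (hpos.pow _).mul (quasipositive_full_twist_mul m hm)
end

section
/- Let n ≥ 2, let Δ² = (σ₁σ₂⋯σ_{n−1})ⁿ ∈ B_n denote the full positive twist, and for each integer k ≥ 0 let u_{k,n} denote the braid word consisting of the positive letters σ₁, σ₂, …, σ_{n−1}, σ_{n−1}, …, σ₂, σ₁ followed by k copies of the block of negative letters σ_{n−1}^{−1} σ_{n−2}^{−1} ⋯ σ₂^{−1} (so u_{k,n} represents the model braid β_{k,n} = (σ₁σ₂⋯σ_{n−1})(σ_{n−1}⋯σ₂σ₁)(σ₂σ₃⋯σ_{n−1})^{−k}). Suppose γ ∈ B_n is represented by some braid word containing no occurrence of the letter σ₁^{−1}. Then there exist k ≥ 0 and a braid word w representing Δ²γ such that w is obtained from u_{k,n} by inserting positive letters. -/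
/-- A braid word is a list of letters `σ_i^{±1}`: the letter `(i, true)` is the
positive letter `σ_{i+1}` and `(i, false)` is the negative letter `σ_{i+1}⁻¹`. -/
def wordEval {n : ℕ} (w : List (Fin (n - 1) × Bool)) : BraidGroup n :=
  (w.map fun p => if p.2 then braidGen p.1 else (braidGen p.1)⁻¹).prod

/-- `w` is obtained from `u` by inserting positive letters: `u` is an
order-preserving subsequence of `w`, and each negative letter `σ_i⁻¹` occurs the
same number of times in `w` as in `u`. -/
def InsertPositive {m : ℕ} (u w : List (Fin m × Bool)) : Prop :=
  u.Sublist w ∧ ∀ i : Fin m, w.count (i, false) = u.count (i, false)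

/-- The ascending positive word `σ₁ σ₂ ⋯ σ_{n-1}`. -/
def ascWord (n : ℕ) : List (Fin (n - 1) × Bool) :=
  (List.finRange (n - 1)).map fun i => (i, true)

/-- The descending positive word `σ_{n-1} ⋯ σ₂ σ₁`. -/
def descWord (n : ℕ) : List (Fin (n - 1) × Bool) :=
  (List.finRange (n - 1)).reverse.map fun i => (i, true)

/-- The negative block `σ_{n-1}⁻¹ σ_{n-2}⁻¹ ⋯ σ₂⁻¹`. -/
def negBlock (n : ℕ) : List (Fin (n - 1) × Bool) :=
  ((List.finRange (n - 1)).drop 1).reverse.map fun i => (i, false)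

/-- The model word `u_{k,n}` representing
`β_{k,n} = (σ₁⋯σ_{n-1})(σ_{n-1}⋯σ₁)(σ₂⋯σ_{n-1})^{-k}`. -/
def modelWord (n k : ℕ) : List (Fin (n - 1) × Bool) :=
  ascWord n ++ descWord n ++ (List.replicate k (negBlock n)).flatten

/-- The full positive twist `Δ² = (σ₁σ₂⋯σ_{n-1})ⁿ ∈ B_n`. -/
def fullTwist (n : ℕ) : BraidGroup n :=
  ((List.finRange (n - 1)).map braidGen).prod ^ n

section ArtinRelations

variable {G : Type*} [Monoid G] {s : ℕ → G}

theorem prod_range_mul_gen (hcomm : ∀ i j, i + 2 ≤ j → s i * s j = s j * s i) {i k : ℕ}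
    (hik : i + 2 ≤ k) (hbraid : s i * s (i + 1) * s i = s (i + 1) * s i * s (i + 1)) :
    ((List.range k).map s).prod * s i = s (i + 1) * ((List.range k).map s).prod := by
  induction k, hik using Nat.le_induction with
  | base =>
    have hpre : Commute (s (i + 1)) ((List.range i).map s).prod := by
      refine Commute.list_prod_right _ _ fun x hx => ?_
      obtain ⟨j, hj, rfl⟩ := List.mem_map.1 hx
      exact (hcomm j (i + 1) (by have := List.mem_range.1 hj; omega)).symm
    simp only [List.range_succ, List.map_append, List.prod_append, List.map_singleton,
      List.prod_singleton]
    calc _ = ((List.range i).map s).prod * (s i * s (i + 1) * s i) := by simp only [mul_assoc]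
      _ = ((List.range i).map s).prod * s (i + 1) * (s i * s (i + 1)) := by
        rw [hbraid]; simp only [mul_assoc]
      _ = _ := by rw [← hpre.eq]; simp only [mul_assoc]
  | succ k hk ih =>
    simp only [List.range_succ, List.map_append, List.prod_append, List.map_singleton,
      List.prod_singleton]
    rw [mul_assoc, ← hcomm i k hk, ← mul_assoc, ih, mul_assoc]

theorem prod_range_reverse_succ (j : ℕ) :
    ((List.range (j + 1)).reverse.map s).prod = s j * ((List.range j).reverse.map s).prod := by
  simp [List.range_succ]

theorem prod_range_eq_mul_drop {m : ℕ} (hm : 0 < m) :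
    ((List.range m).map s).prod = s 0 * (((List.range m).drop 1).map s).prod := by
  obtain ⟨m, rfl⟩ := Nat.exists_eq_succ_of_ne_zero hm.ne'
  simp [List.range_succ_eq_map]

theorem prod_range_mul_reverse (hcomm : ∀ i j, i + 2 ≤ j → s i * s j = s j * s i) {m : ℕ}
    (hbraid : ∀ i, i + 1 < m → s i * s (i + 1) * s i = s (i + 1) * s i * s (i + 1))
    (j : ℕ) (hj : j < m) :
    ((List.range m).map s).prod * ((List.range j).reverse.map s).prod =
      ((List.range (j + 1)).reverse.map s).prod * (((List.range m).drop 1).map s).prod := by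
  induction j with
  | zero => simpa using prod_range_eq_mul_drop hj
  | succ j ih =>
    rw [prod_range_reverse_succ j, ← mul_assoc, prod_range_mul_gen hcomm hj (hbraid j hj),
      mul_assoc, ih (by omega), prod_range_reverse_succ (j + 1), mul_assoc]

theorem prod_range_pow (hcomm : ∀ i j, i + 2 ≤ j → s i * s j = s j * s i) {m : ℕ}
    (hbraid : ∀ i, i + 1 < m → s i * s (i + 1) * s i = s (i + 1) * s i * s (i + 1))
    (j : ℕ) (hj : j ≤ m) :
    ((List.range m).map s).prod ^ j =
      ((List.range j).reverse.map s).prod * (((List.range m).drop 1).map s).prod ^ j := by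
  induction j with
  | zero => simp
  | succ j ih =>
    rw [pow_succ', ih (by omega), ← mul_assoc, prod_range_mul_reverse hcomm hbraid j hj,
      mul_assoc, ← pow_succ']

end ArtinRelations

theorem braidGen_comm {n : ℕ} {i j : Fin (n - 1)} (h : (i : ℕ) + 2 ≤ j) :
    (braidGen i * braidGen j : BraidGroup n) = braidGen j * braidGen i := by
  have := PresentedGroup.one_of_mem (rels := braidRels (n - 1)) (Or.inl ⟨i, j, h, rfl⟩)
  simp only [map_mul, map_inv] at this
  rwa [mul_inv_eq_one, mul_inv_eq_iff_eq_mul] at this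

theorem braidGen_braid {n : ℕ} {i j : Fin (n - 1)} (h : (j : ℕ) = i + 1) :
    (braidGen i * braidGen j * braidGen i : BraidGroup n) =
      braidGen j * braidGen i * braidGen j := by
  have := PresentedGroup.one_of_mem (rels := braidRels (n - 1)) (Or.inr ⟨i, j, h, rfl⟩)
  simp only [map_mul, map_inv] at this
  rwa [mul_inv_eq_one] at this

/-- The generators of `B_n` indexed by all natural numbers, trivial out of range. -/
def natBraidGen (n i : ℕ) : BraidGroup n :=
  if h : i < n - 1 then braidGen ⟨i, h⟩ else 1

theorem natBraidGen_val {n : ℕ} (i : Fin (n - 1)) : natBraidGen n i = braidGen i := by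
  simp [natBraidGen]

theorem map_natBraidGen_val {n : ℕ} (l : List (Fin (n - 1))) :
    (l.map Fin.val).map (natBraidGen n) = l.map braidGen := by
  simp [natBraidGen_val]

theorem fullTwist_eq {n : ℕ} (hn : 1 ≤ n) :
    fullTwist n = ((List.finRange (n - 1)).map braidGen).prod *
      ((List.finRange (n - 1)).reverse.map braidGen).prod *
      (((List.finRange (n - 1)).drop 1).map braidGen).prod ^ (n - 1) := by
  have hcomm : ∀ i j, i + 2 ≤ j →
      natBraidGen n i * natBraidGen n j = natBraidGen n j * natBraidGen n i := by
    intro i j hij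
    unfold natBraidGen
    split_ifs
    · exact braidGen_comm hij
    all_goals simp
  have hbraid : ∀ i, i + 1 < n - 1 → natBraidGen n i * natBraidGen n (i + 1) * natBraidGen n i =
      natBraidGen n (i + 1) * natBraidGen n i * natBraidGen n (i + 1) := by
    intro i hi
    rw [natBraidGen, natBraidGen, dif_pos hi, dif_pos (by omega)]
    exact braidGen_braid rfl
  have h := prod_range_pow hcomm hbraid (n - 1) le_rfl
  rw [← List.map_coe_finRange_eq_range, ← List.map_reverse, ← List.map_drop,
    map_natBraidGen_val, map_natBraidGen_val, map_natBraidGen_val] at h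
  rw [fullTwist, mul_assoc, ← h, ← pow_succ', Nat.sub_add_cancel hn]

theorem wordEval_append {n : ℕ} (u w : List (Fin (n - 1) × Bool)) :
    wordEval (u ++ w) = wordEval u * wordEval w := by
  simp [wordEval]

theorem wordEval_positive {n : ℕ} (l : List (Fin (n - 1))) :
    wordEval (l.map fun i => (i, true)) = (l.map braidGen).prod := by
  simp [wordEval, Function.comp_def]

theorem wordEval_reverse_negative {n : ℕ} (l : List (Fin (n - 1))) :
    wordEval (l.reverse.map fun i => (i, false)) = (l.map braidGen).prod⁻¹ := by
  simp [wordEval, Function.comp_def, List.prod_inv_reverse]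

theorem wordEval_flatten_replicate {n : ℕ} (k : ℕ) (w : List (Fin (n - 1) × Bool)) :
    wordEval (List.replicate k w).flatten = wordEval w ^ k := by
  induction k with
  | zero => simp [wordEval]
  | succ k ih => rw [List.replicate_succ, List.flatten_cons, wordEval_append, ih, pow_succ']

namespace InsertPositive

variable {m : ℕ} {u u' w w' : List (Fin m × Bool)}

theorem refl (u : List (Fin m × Bool)) : InsertPositive u u :=
  ⟨List.Sublist.refl u, fun _ => rfl⟩

theorem append (h : InsertPositive u w) (h' : InsertPositive u' w') :
    InsertPositive (u ++ u') (w ++ w') :=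
  ⟨h.1.append h'.1, fun i => by rw [List.count_append, List.count_append, h.2, h'.2]⟩

theorem nil_of_positive (h : ∀ p ∈ w, p.2 = true) : InsertPositive [] w :=
  ⟨List.nil_sublist w, fun i => List.count_eq_zero.2 fun hi => by simpa using h _ hi⟩

theorem nil_map (l : List (Fin m)) : InsertPositive [] (l.map fun i => (i, true)) :=
  nil_of_positive (by simp)

end InsertPositive

theorem exists_insertPositive_negBlock {n : ℕ} (i : Fin (n - 1)) (hi : (i : ℕ) ≠ 0) :
    ∃ w : List (Fin (n - 1) × Bool),
      wordEval w = (braidGen i)⁻¹ ∧ InsertPositive (negBlock n) w := by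
  have hmem : i ∈ (List.finRange (n - 1)).drop 1 := by
    refine List.mem_drop_iff_getElem.2 ⟨i - 1, by simp; omega, ?_⟩
    ext
    simp
    omega
  obtain ⟨x, y, hxy⟩ := List.append_of_mem hmem
  refine ⟨y.map (fun i => (i, true)) ++ negBlock n ++ x.map (fun i => (i, true)), ?_, ?_⟩
  · rw [wordEval_append, wordEval_append, wordEval_positive, wordEval_positive, negBlock,
      wordEval_reverse_negative, hxy]
    simp only [List.map_append, List.map_cons, List.prod_append, List.prod_cons]
    group
  · simpa using ((InsertPositive.nil_map y).append (.refl (negBlock n))).append (.nil_map x)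

theorem exists_insertPositive_replicate_negBlock {n : ℕ} (v : List (Fin (n - 1) × Bool))
    (hv : ∀ i : Fin (n - 1), (i, false) ∈ v → (i : ℕ) ≠ 0) :
    ∃ (k : ℕ) (w : List (Fin (n - 1) × Bool)), wordEval w = wordEval v ∧
      InsertPositive (List.replicate k (negBlock n)).flatten w := by
  induction v with
  | nil => exact ⟨0, [], rfl, .refl _⟩
  | cons p v ih =>
    obtain ⟨k, w, hw, hins⟩ := ih fun i hi => hv i (List.mem_cons_of_mem _ hi)
    obtain ⟨i, _ | _⟩ := p
    · obtain ⟨b, hb, hbins⟩ := exists_insertPositive_negBlock i (hv i List.mem_cons_self)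
      refine ⟨k + 1, b ++ w, ?_, ?_⟩
      · rw [wordEval_append, hb, hw]
        simp [wordEval]
      · rw [List.replicate_succ, List.flatten_cons]
        exact hbins.append hins
    · refine ⟨k, [(i, true)] ++ w, ?_, (InsertPositive.nil_map [i]).append hins⟩
      rw [wordEval_append, hw]
      simp [wordEval]

/-- If `γ ∈ B_n` admits a braid word with no occurrence of the letter `σ₁⁻¹`,
then `Δ²γ` is represented by a word obtained from some model word `u_{k,n}` by
inserting positive letters. -/
theorem fullTwist_mul_sigmaOneInverseFree_from_model (n : ℕ) (hn : 2 ≤ n)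
    (γ : BraidGroup n)
    (hγ : ∃ v : List (Fin (n - 1) × Bool), wordEval v = γ ∧
      ((⟨0, by omega⟩ : Fin (n - 1)), false) ∉ v) :
    ∃ (k : ℕ) (w : List (Fin (n - 1) × Bool)),
      wordEval w = fullTwist n * γ ∧ InsertPositive (modelWord n k) w := by
  obtain ⟨v, rfl, hv⟩ := hγ
  obtain ⟨k, w, hw, hins⟩ := exists_insertPositive_replicate_negBlock v fun i hi h0 =>
    hv (by rwa [show (⟨0, by omega⟩ : Fin (n - 1)) = i from Fin.ext h0.symm])
  let ε : List (Fin (n - 1) × Bool) := ((List.finRange (n - 1)).drop 1).map fun i => (i, true)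
  have hε : InsertPositive [] (List.replicate (n - 1) ε).flatten :=
    .nil_of_positive fun p hp => by
      obtain ⟨l, hl, hpl⟩ := List.mem_flatten.1 hp
      rw [List.eq_of_mem_replicate hl] at hpl
      obtain ⟨i, -, rfl⟩ := List.mem_map.1 hpl
      rfl
  refine ⟨k, ascWord n ++ descWord n ++ (List.replicate (n - 1) ε).flatten ++ w, ?_, ?_⟩
  · rw [wordEval_append, wordEval_append, wordEval_append, wordEval_flatten_replicate, hw,
      ascWord, descWord, wordEval_positive, wordEval_positive, wordEval_positive,
      fullTwist_eq (by omega)]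
  · simpa [modelWord] using ((InsertPositive.refl (ascWord n ++ descWord n)).append hε).append hins
end

section
/- In B₃ let Δ = σ₁σ₂σ₁ be the Garside element. Then: (i) the braids Δ²σ₁σ₂^{−1} and Δ²σ₂σ₁^{−1} are conjugate in B₃; (ii) the element Δ^{−2}·(Δ²σ₁σ₂^{−1}) is represented by a σ-positive braid word (hence Δ²σ₁σ₂^{−1} ⪰ Δ² in Dehornoy's ordering, so its Dehornoy floor is at least 1); (iii) the element (Δ²σ₂σ₁^{−1})^{−1}·Δ² is represented by a σ-positive braid word (hence Δ²σ₂σ₁^{−1} ≺ Δ², so its Dehornoy floor is at most 0). In particular, the Dehornoy floor is not invariant under conjugation. -/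
/-- A braid word is σ-positive if for some index `i` it contains the positive
letter `σ_i`, no letter `σ_i⁻¹`, and no letters `σ_j^{±1}` with `j < i`. -/
def SigmaPositive {m : ℕ} (w : List (Fin m × Bool)) : Prop :=
  ∃ i : Fin m, (i, true) ∈ w ∧ (i, false) ∉ w ∧
    ∀ j : Fin m, j < i → ∀ b : Bool, (j, b) ∉ w

/-- The Garside element `Δ = σ₁σ₂σ₁ ∈ B₃`. -/
def Δ : BraidGroup 3 := σ₁ * σ₂ * σ₁

theorem semiconjBy_Δ_σ₁_σ₂ : SemiconjBy Δ σ₁ σ₂ := by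
  simp only [SemiconjBy, Δ]
  nth_rewrite 1 [braid_relation]
  simp only [mul_assoc]

theorem semiconjBy_Δ_σ₂_σ₁ : SemiconjBy Δ σ₂ σ₁ := by
  simp only [SemiconjBy, Δ]
  rw [mul_assoc (σ₁ * σ₂), mul_assoc σ₁ σ₂, ← mul_assoc σ₂, braid_relation]

theorem exists_sigmaPositive_wordEval_eq_σ₁_mul_σ₂_inv :
    ∃ w : List (Fin (3 - 1) × Bool), SigmaPositive w ∧ wordEval w = σ₁ * σ₂⁻¹ := by
  refine ⟨[(⟨0, by norm_num⟩, true), (⟨1, by norm_num⟩, false)],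
    ⟨⟨0, by norm_num⟩, by simp, by simp, fun j hj => absurd hj (Nat.not_lt_zero _)⟩, ?_⟩
  simp [wordEval, σ₁, σ₂]

/-- (i) `Δ²σ₁σ₂⁻¹` and `Δ²σ₂σ₁⁻¹` are conjugate in `B₃`;
(ii) `Δ⁻²·(Δ²σ₁σ₂⁻¹)` admits a σ-positive word, so `Δ²σ₁σ₂⁻¹ ⪰ Δ²` in
Dehornoy's ordering and its Dehornoy floor is at least 1;
(iii) `(Δ²σ₂σ₁⁻¹)⁻¹·Δ²` admits a σ-positive word, so `Δ²σ₂σ₁⁻¹ ≺ Δ²` and its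
Dehornoy floor is at most 0. Hence the Dehornoy floor is not conjugacy
invariant. -/
theorem dehornoy_floor_not_conjugacy_invariant :
    IsConj (Δ ^ 2 * σ₁ * σ₂⁻¹) (Δ ^ 2 * σ₂ * σ₁⁻¹) ∧
    (∃ w : List (Fin (3 - 1) × Bool), SigmaPositive w ∧
      wordEval w = (Δ ^ 2)⁻¹ * (Δ ^ 2 * σ₁ * σ₂⁻¹)) ∧
    (∃ w : List (Fin (3 - 1) × Bool), SigmaPositive w ∧
      wordEval w = (Δ ^ 2 * σ₂ * σ₁⁻¹)⁻¹ * Δ ^ 2) := by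
  refine ⟨isConj_iff.mpr ⟨Δ, ?_⟩, ?_, ?_⟩
  · rw [mul_inv_eq_iff_eq_mul]
    exact (SemiconjBy.mul_right ((Commute.refl Δ).pow_right 2) semiconjBy_Δ_σ₁_σ₂).mul_right
      semiconjBy_Δ_σ₂_σ₁.inv_right
  · rw [mul_assoc (Δ ^ 2), inv_mul_cancel_left]
    exact exists_sigmaPositive_wordEval_eq_σ₁_mul_σ₂_inv
  · have h : (Δ ^ 2 * σ₂ * σ₁⁻¹)⁻¹ * Δ ^ 2 = σ₁ * σ₂⁻¹ := by group
    rw [h]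
    exact exists_sigmaPositive_wordEval_eq_σ₁_mul_σ₂_inv
end
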